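/- arXiv:2006.11531 — 3 statements merged into one kernel-verified Lean document; each statement's English description precedes it below -/
import Mathlib

section
/- For every β ∈ (0,2] and every dimension n ≥ 1 there exist constants c₁ = c₁(β) > 0 and c₂ = c₂(β) > 0 such that for all t ≥ 0 and all k, ξ ∈ ℝⁿ one has exp(−c₁|ξ+tk|^β t − c₁|k|^β t^{β+1}) ≤ e_β(t,k,ξ) ≤ exp(−c₂|ξ+tk|^β t − c₂|k|^β t^{β+1}). -/
open MeasureTheory Set Filter
open scoped ENNReal

noncomputable section

/-- `ℝⁿ` with the Euclidean norm. -/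
abbrev En (n : ℕ) : Type := EuclideanSpace ℝ (Fin n)

/-- `e_β(t,k,ξ) = exp(−∫₀ᵗ ‖ξ + σ k‖^β dσ)`. -/
def eB (n : ℕ) (β t : ℝ) (k ξ : En n) : ℝ :=
  Real.exp (-(∫ σ in (0:ℝ)..t, ‖ξ + σ • k‖ ^ β))

lemma rpow_le_four_mul_rpow {β x y : ℝ} (hβ : β ∈ Ioc (0:ℝ) 2) (hx : 0 ≤ x) (hy : 0 ≤ y)
    (h : x ≤ 2 * y) : x ^ β ≤ 4 * y ^ β := by
  have h4 : (2:ℝ) ^ β ≤ 4 := by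
    calc (2:ℝ) ^ β ≤ (2:ℝ) ^ (2:ℝ) := Real.rpow_le_rpow_of_exponent_le (by norm_num) hβ.2
      _ = 4 := by norm_num
  calc x ^ β ≤ (2 * y) ^ β := Real.rpow_le_rpow hx h hβ.1.le
    _ = 2 ^ β * y ^ β := Real.mul_rpow (by norm_num) hy
    _ ≤ 4 * y ^ β := by gcongr

section PathIntegral

variable {E : Type*} [NormedAddCommGroup E] [NormedSpace ℝ E]

lemma continuous_norm_add_smul_rpow {β : ℝ} (hβ : 0 ≤ β) (k ξ : E) :
    Continuous fun σ : ℝ => ‖ξ + σ • k‖ ^ β :=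
  Continuous.rpow_const (by fun_prop) fun _ => Or.inr hβ

lemma norm_add_smul_sub_add_smul (k ξ : E) (σ τ : ℝ) :
    ‖(ξ + σ • k) - (ξ + τ • k)‖ = |σ - τ| * ‖k‖ := by
  rw [add_sub_add_left_eq_sub, ← sub_smul, norm_smul, Real.norm_eq_abs]

lemma integral_norm_add_smul_rpow_le {β t : ℝ} (hβ : β ∈ Ioc (0:ℝ) 2) (ht : 0 ≤ t) (k ξ : E) :
    ∫ σ in (0:ℝ)..t, ‖ξ + σ • k‖ ^ β ≤ 4 * (‖ξ + t • k‖ ^ β + (t * ‖k‖) ^ β) * t := by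
  have hcont := continuous_norm_add_smul_rpow hβ.1.le k ξ
  have hA : 0 ≤ ‖ξ + t • k‖ ^ β := by positivity
  have hB : 0 ≤ (t * ‖k‖) ^ β := by positivity
  have key : ∀ σ ∈ Icc (0:ℝ) t,
      ‖ξ + σ • k‖ ^ β ≤ 4 * (‖ξ + t • k‖ ^ β + (t * ‖k‖) ^ β) := by
    intro σ hσ
    have h1 := norm_sub_norm_le (ξ + σ • k) (ξ + t • k)
    rw [norm_add_smul_sub_add_smul, abs_sub_comm, abs_of_nonneg (sub_nonneg.2 hσ.2)] at h1
    have h2 : (t - σ) * ‖k‖ ≤ t * ‖k‖ := by gcongr; linarith [hσ.1]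
    rcases le_total ‖ξ + t • k‖ (t * ‖k‖) with h | h
    · have := rpow_le_four_mul_rpow hβ (norm_nonneg (ξ + σ • k))
        (by positivity : 0 ≤ t * ‖k‖) (by linarith)
      linarith
    · have := rpow_le_four_mul_rpow hβ (norm_nonneg (ξ + σ • k))
        (norm_nonneg (ξ + t • k)) (by linarith)
      linarith
  have := intervalIntegral.integral_mono_on ht (hcont.intervalIntegrable 0 t)
    (intervalIntegrable_const (μ := volume)) key
  rw [intervalIntegral.integral_const, smul_eq_mul] at this
  linarith

lemma mul_rpow_le_integral_norm_add_smul {β t : ℝ} (hβ : β ∈ Ioc (0:ℝ) 2) (ht : 0 ≤ t)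
    (k ξ : E) :
    (t * ‖k‖) ^ β * t ≤ 32 * ∫ σ in (0:ℝ)..t, ‖ξ + σ • k‖ ^ β := by
  have hcont := continuous_norm_add_smul_rpow hβ.1.le k ξ
  have hshift : Continuous fun σ : ℝ => ‖ξ + (σ + t / 2) • k‖ ^ β :=
    hcont.comp (continuous_id.add continuous_const)
  have hsplit : ∫ σ in (0:ℝ)..t, ‖ξ + σ • k‖ ^ β =
      ∫ σ in (0:ℝ)..(t / 2), (‖ξ + σ • k‖ ^ β + ‖ξ + (σ + t / 2) • k‖ ^ β) := by
    rw [intervalIntegral.integral_add (hcont.intervalIntegrable _ _)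
      (hshift.intervalIntegrable _ _),
      intervalIntegral.integral_comp_add_right (fun σ : ℝ => ‖ξ + σ • k‖ ^ β) (t / 2),
      zero_add, add_halves,
      intervalIntegral.integral_add_adjacent_intervals (hcont.intervalIntegrable _ _)
      (hcont.intervalIntegrable _ _)]
  have key : ∀ σ ∈ Icc (0:ℝ) (t / 2),
      (t * ‖k‖) ^ β / 16 ≤ ‖ξ + σ • k‖ ^ β + ‖ξ + (σ + t / 2) • k‖ ^ β := by
    intro σ _
    have h1 := norm_sub_le (ξ + (σ + t / 2) • k) (ξ + σ • k)
    rw [norm_add_smul_sub_add_smul, add_sub_cancel_left, abs_of_nonneg (by positivity)] at h1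
    have hk : 0 ≤ t * ‖k‖ := by positivity
    have hP : 0 ≤ ‖ξ + σ • k‖ ^ β := by positivity
    have hQ : 0 ≤ ‖ξ + (σ + t / 2) • k‖ ^ β := by positivity
    have h2 := rpow_le_four_mul_rpow hβ hk (by positivity : 0 ≤ t * ‖k‖ / 2) (by linarith)
    rcases le_total ‖ξ + σ • k‖ ‖ξ + (σ + t / 2) • k‖ with h | h
    · have := rpow_le_four_mul_rpow hβ (by positivity : 0 ≤ t * ‖k‖ / 2)
        (norm_nonneg (ξ + (σ + t / 2) • k)) (by linarith)
      linarith
    · have := rpow_le_four_mul_rpow hβ (by positivity : 0 ≤ t * ‖k‖ / 2)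
        (norm_nonneg (ξ + σ • k)) (by linarith)
      linarith
  have := intervalIntegral.integral_mono_on (by positivity : (0:ℝ) ≤ t / 2)
    (intervalIntegrable_const (μ := volume))
    ((hcont.add hshift).intervalIntegrable 0 (t / 2)) key
  simp only [Pi.add_apply] at this
  rw [intervalIntegral.integral_const, smul_eq_mul, ← hsplit] at this
  linarith

lemma le_integral_norm_add_smul_rpow {β t : ℝ} (hβ : β ∈ Ioc (0:ℝ) 2) (ht : 0 ≤ t) (k ξ : E) :
    (‖ξ + t • k‖ ^ β + (t * ‖k‖) ^ β) * t ≤ 160 * ∫ σ in (0:ℝ)..t, ‖ξ + σ • k‖ ^ β := by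
  have hcont := continuous_norm_add_smul_rpow hβ.1.le k ξ
  have hB := mul_rpow_le_integral_norm_add_smul hβ ht k ξ
  have hk : 0 ≤ t * ‖k‖ := by positivity
  have hBt : 0 ≤ (t * ‖k‖) ^ β * t := by positivity
  rcases le_total ‖ξ + t • k‖ (2 * (t * ‖k‖)) with h | h
  · have hA := mul_le_mul_of_nonneg_right
      (rpow_le_four_mul_rpow hβ (norm_nonneg (ξ + t • k)) hk h) ht
    linarith
  · have key : ∀ σ ∈ Icc (0:ℝ) t, ‖ξ + t • k‖ ^ β / 4 ≤ ‖ξ + σ • k‖ ^ β := by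
      intro σ hσ
      have h1 := norm_sub_norm_le (ξ + t • k) (ξ + σ • k)
      rw [norm_add_smul_sub_add_smul, abs_of_nonneg (sub_nonneg.2 hσ.2)] at h1
      have h2 : (t - σ) * ‖k‖ ≤ t * ‖k‖ := by gcongr; linarith [hσ.1]
      have := rpow_le_four_mul_rpow hβ (norm_nonneg (ξ + t • k))
        (norm_nonneg (ξ + σ • k)) (by linarith)
      linarith
    have := intervalIntegral.integral_mono_on ht (intervalIntegrable_const (μ := volume))
      (hcont.intervalIntegrable 0 t) key
    rw [intervalIntegral.integral_const, smul_eq_mul] at this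
    linarith

end PathIntegral

theorem stmt0 (β : ℝ) (hβ : β ∈ Ioc (0:ℝ) 2) :
    ∃ c₁ c₂ : ℝ, 0 < c₁ ∧ 0 < c₂ ∧
      ∀ n : ℕ, 1 ≤ n → ∀ t : ℝ, 0 ≤ t → ∀ k ξ : En n,
        Real.exp (-c₁ * ‖ξ + t • k‖ ^ β * t - c₁ * ‖k‖ ^ β * t ^ (β + 1)) ≤ eB n β t k ξ ∧
        eB n β t k ξ ≤ Real.exp (-c₂ * ‖ξ + t • k‖ ^ β * t - c₂ * ‖k‖ ^ β * t ^ (β + 1)) := by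
  refine ⟨4, 1 / 160, by norm_num, by norm_num, fun n _ t ht k ξ => ?_⟩
  have hpow : ‖k‖ ^ β * t ^ (β + 1) = (t * ‖k‖) ^ β * t := by
    rw [Real.rpow_add_one' ht (by linarith [hβ.1]), Real.mul_rpow ht (norm_nonneg k)]
    ring
  have hupper := integral_norm_add_smul_rpow_le hβ ht k ξ
  have hlower := le_integral_norm_add_smul_rpow hβ ht k ξ
  constructor <;> refine Real.exp_le_exp.2 ?_ <;> rw [mul_assoc _ (‖k‖ ^ β), hpow] <;> linarith
end
end

section
/- Let β ∈ (0,2], s ≥ −1/2, μ ∈ (1/2,1] and T ∈ (0,∞). There exists a constant c = c(s,β,μ,T) > 0 such that for every measurable function F : (0,T) × ℝⁿ × ℝⁿ → ℂ with ∫₀ᵀ ∫_{ℝ^{2n}} t^{2−2μ} ω_β(k,ξ)^{2s} |F(t,k,ξ)|² dk dξ dt < ∞, the function U defined by U(t,k,ξ) = ∫₀ᵗ F(τ,k,ξ+(t−τ)k) e_β(t−τ,k,ξ) dτ satisfies ∫₀ᵀ ∫_{ℝ^{2n}} t^{2−2μ} ω_β(k,ξ)^{2(s+1)} |U(t,k,ξ)|²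 dk dξ dt ≤ c ∫₀ᵀ ∫_{ℝ^{2n}} t^{2−2μ} ω_β(k,ξ)^{2s} |F(t,k,ξ)|² dk dξ dt. -/
open MeasureTheory Set Filter
open scoped ENNReal

noncomputable section

/-- `ω_β(k,ξ) = 1 + ‖k‖^{β/(β+1)} + ‖ξ‖^β`. -/
def omegaB (n : ℕ) (β : ℝ) (k ξ : En n) : ℝ := 1 + ‖k‖ ^ (β / (β + 1)) + ‖ξ‖ ^ β

/-- The exponential kernel `a exp(-a r / 128)` on `r > 0`. -/
def expKer (a r : ℝ) : ℝ≥0∞ :=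
  (Ioi (0:ℝ)).indicator (fun r => ENNReal.ofReal (a * Real.exp (-(a / 128) * r))) r

lemma measurable_expKer : Measurable (fun p : ℝ × ℝ => expKer p.1 p.2) := by
  have : (fun p : ℝ × ℝ => expKer p.1 p.2) = (Prod.snd ⁻¹' Ioi (0:ℝ)).indicator
      (fun p => ENNReal.ofReal (p.1 * Real.exp (-(p.1 / 128) * p.2))) := by
    ext p
    simp only [expKer, indicator, mem_preimage]
  rw [this]
  exact Measurable.indicator (by fun_prop) (measurable_snd measurableSet_Ioi)

lemma lintegral_expKer {a : ℝ} (ha : 0 < a) : ∫⁻ r, expKer a r = ENNReal.ofReal 128 := by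
  have hneg : -(a / 128) < 0 := by linarith [div_pos ha (by norm_num : (0:ℝ) < 128)]
  unfold expKer
  rw [lintegral_indicator measurableSet_Ioi, ← ofReal_integral_eq_lintegral_ofReal]
  · rw [integral_const_mul, integral_exp_mul_Ioi hneg]
    congr 1
    simp
    field_simp
  · exact (integrableOn_exp_mul_Ioi hneg 0).const_mul a
  · exact ae_of_all _ fun r => by positivity

/-- Cauchy–Schwarz for lower integrals, with a pointwise domination. -/
lemma sq_lintegral_le_mul {α : Type*} [MeasurableSpace α] {ν : Measure α} {f g h : α → ℝ≥0∞}
    (hg : AEMeasurable g ν) (hh : AEMeasurable h ν) (hf : ∀ᵐ x ∂ν, f x ^ 2 ≤ g x * h x) :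
    (∫⁻ x, f x ∂ν) ^ 2 ≤ (∫⁻ x, g x ∂ν) * ∫⁻ x, h x ∂ν := by
  have hpow : ∀ y : ℝ≥0∞, (y ^ (1 / 2 : ℝ)) ^ (2 : ℝ) = y := fun y => by
    rw [← ENNReal.rpow_mul]; norm_num
  have hle : ∫⁻ x, f x ∂ν ≤ (∫⁻ x, g x ∂ν) ^ (1 / 2 : ℝ) * (∫⁻ x, h x ∂ν) ^ (1 / 2 : ℝ) := by
    calc ∫⁻ x, f x ∂ν ≤ ∫⁻ x, g x ^ (1 / 2 : ℝ) * h x ^ (1 / 2 : ℝ) ∂ν := by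
          refine lintegral_mono_ae (hf.mono fun x hx => ?_)
          rw [← ENNReal.mul_rpow_of_nonneg _ _ (by norm_num : (0:ℝ) ≤ 1 / 2)]
          refine le_trans (le_of_eq ?_) (ENNReal.rpow_le_rpow hx (by norm_num))
          rw [← ENNReal.rpow_natCast, ← ENNReal.rpow_mul]
          norm_num
      _ ≤ _ := by
          have := ENNReal.lintegral_mul_le_Lp_mul_Lq ν
            (Real.HolderConjugate.two_two) (hg.pow_const (1 / 2 : ℝ)) (hh.pow_const (1 / 2 : ℝ))
          simpa only [Pi.mul_apply, hpow] using this
  calc (∫⁻ x, f x ∂ν) ^ 2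
      ≤ ((∫⁻ x, g x ∂ν) ^ (1 / 2 : ℝ) * (∫⁻ x, h x ∂ν) ^ (1 / 2 : ℝ)) ^ 2 := by gcongr
    _ = _ := by
      rw [mul_pow, ← ENNReal.rpow_two, ← ENNReal.rpow_two, hpow, hpow]

lemma Measurable.comp_triple {E X : Type*} [MeasurableSpace E] [MeasurableSpace X]
    {f : ℝ → E → E → ℝ≥0∞} (hf : Measurable fun p : ℝ × E × E => f p.1 p.2.1 p.2.2)
    {a : X → ℝ} {b c : X → E} (ha : Measurable a) (hb : Measurable b) (hc : Measurable c) :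
    Measurable fun x => f (a x) (b x) (c x) :=
  hf.comp (ha.prodMk (hb.prodMk hc))

/-- Convolution along the free transport with a kernel of bounded mass is bounded on `L¹`. -/
lemma lintegral_transport_le {E : Type*} [NormedAddCommGroup E] [NormedSpace ℝ E]
    [MeasurableSpace E] [BorelSpace E] [SecondCountableTopology E] {ν : Measure E} [SFinite ν]
    [ν.IsAddRightInvariant] {K Φ : ℝ → E → E → ℝ≥0∞}
    (hK : Measurable fun p : ℝ × E × E => K p.1 p.2.1 p.2.2)
    (hΦ : Measurable fun p : ℝ × E × E => Φ p.1 p.2.1 p.2.2)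
    {C : ℝ≥0∞} (hC : ∀ k ξ, ∫⁻ r, K r k ξ ≤ C) :
    ∫⁻ t : ℝ, ∫⁻ k, ∫⁻ ξ, (∫⁻ τ : ℝ, K (t - τ) k (ξ + (t - τ) • k) * Φ τ k (ξ + (t - τ) • k)) ∂ν ∂ν
      ≤ C * ∫⁻ τ : ℝ, ∫⁻ k, ∫⁻ ξ, Φ τ k ξ ∂ν ∂ν := by
  calc ∫⁻ t : ℝ, ∫⁻ k, ∫⁻ ξ, (∫⁻ τ : ℝ, K (t - τ) k (ξ + (t - τ) • k) * Φ τ k (ξ + (t - τ) • k)) ∂ν ∂ν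
      = ∫⁻ t : ℝ, ∫⁻ k, (∫⁻ τ : ℝ, ∫⁻ ξ, K (t - τ) k ξ * Φ τ k ξ ∂ν) ∂ν := by
        refine lintegral_congr fun t => lintegral_congr fun k => ?_
        rw [lintegral_lintegral_swap]
        · exact lintegral_congr fun τ =>
            lintegral_add_right_eq_self (fun ξ => K (t - τ) k ξ * Φ τ k ξ) ((t - τ) • k)
        · exact ((hK.comp_triple (by fun_prop) (by fun_prop) (by fun_prop)).mul
            (hΦ.comp_triple (by fun_prop) (by fun_prop) (by fun_prop))).aemeasurable
    _ = ∫⁻ k, (∫⁻ t : ℝ, ∫⁻ τ : ℝ, ∫⁻ ξ, K (t - τ) k ξ * Φ τ k ξ ∂ν) ∂ν := by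
        refine lintegral_lintegral_swap (Measurable.aemeasurable ?_)
        refine Measurable.lintegral_prod_right' (f := fun q : (ℝ × E) × ℝ =>
          ∫⁻ ξ, K (q.1.1 - q.2) q.1.2 ξ * Φ q.2 q.1.2 ξ ∂ν) ?_
        refine Measurable.lintegral_prod_right' (f := fun q : ((ℝ × E) × ℝ) × E =>
          K (q.1.1.1 - q.1.2) q.1.1.2 q.2 * Φ q.1.2 q.1.1.2 q.2) ?_
        exact (hK.comp_triple (by fun_prop) (by fun_prop) (by fun_prop)).mul
            (hΦ.comp_triple (by fun_prop) (by fun_prop) (by fun_prop))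
    _ = ∫⁻ k, (∫⁻ τ : ℝ, ∫⁻ ξ, (∫⁻ t : ℝ, K (t - τ) k ξ * Φ τ k ξ) ∂ν) ∂ν := by
        refine lintegral_congr fun k => ?_
        rw [lintegral_lintegral_swap]
        · refine lintegral_congr fun τ => ?_
          rw [lintegral_lintegral_swap]
          exact ((hK.comp_triple (by fun_prop) (by fun_prop) (by fun_prop)).mul
            (hΦ.comp_triple (by fun_prop) (by fun_prop) (by fun_prop))).aemeasurable
        · refine Measurable.aemeasurable (Measurable.lintegral_prod_right'
            (f := fun q : (ℝ × ℝ) × E => K (q.1.1 - q.1.2) k q.2 * Φ q.1.2 k q.2) ?_)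
          exact (hK.comp_triple (by fun_prop) (by fun_prop) (by fun_prop)).mul
            (hΦ.comp_triple (by fun_prop) (by fun_prop) (by fun_prop))
    _ ≤ ∫⁻ k, (∫⁻ τ : ℝ, ∫⁻ ξ, C * Φ τ k ξ ∂ν) ∂ν := by
        gcongr with k τ ξ
        rw [lintegral_mul_const _ (hK.comp_triple (by fun_prop) (by fun_prop) (by fun_prop)),
          lintegral_sub_right_eq_self (fun r => K r k ξ) τ]
        gcongr
        exact hC k ξ
    _ = ∫⁻ τ : ℝ, ∫⁻ k, ∫⁻ ξ, C * Φ τ k ξ ∂ν ∂ν := by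
        refine lintegral_lintegral_swap (Measurable.aemeasurable ?_)
        refine Measurable.lintegral_prod_right'
            (f := fun q : (E × ℝ) × E => C * Φ q.1.2 q.1.1 q.2) ?_
        exact (hΦ.comp_triple (by fun_prop) (by fun_prop) (by fun_prop)).const_mul _
    _ = C * ∫⁻ τ : ℝ, ∫⁻ k, ∫⁻ ξ, Φ τ k ξ ∂ν ∂ν := by
        have h1 : Measurable fun q : ℝ × E => ∫⁻ ξ, Φ q.1 q.2 ξ ∂ν :=
          Measurable.lintegral_prod_right' (f := fun q : (ℝ × E) × E => Φ q.1.1 q.1.2 q.2)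
            (hΦ.comp_triple (by fun_prop) (by fun_prop) (by fun_prop))
        have h2 : Measurable fun τ : ℝ => ∫⁻ k, ∫⁻ ξ, Φ τ k ξ ∂ν ∂ν :=
          Measurable.lintegral_prod_right' (f := fun q : ℝ × E => ∫⁻ ξ, Φ q.1 q.2 ξ ∂ν) h1
        rw [← lintegral_const_mul _ h2]
        refine lintegral_congr fun τ => ?_
        rw [← lintegral_const_mul (f := fun k => ∫⁻ ξ, Φ τ k ξ ∂ν) _
          (h1.comp (by fun_prop : Measurable fun k : E => (τ, k)))]
        refine lintegral_congr fun k => ?_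
        exact lintegral_const_mul _ (hΦ.comp_triple (by fun_prop) (by fun_prop) (by fun_prop))

lemma lintegral_expKer_mul_rpow_le {a t δ : ℝ} (ha : 0 < a) (ht : 0 < t) (hδ0 : 0 ≤ δ)
    (hδ1 : δ < 1) :
    ∫⁻ τ in Ioo 0 t, expKer a (t - τ) * ENNReal.ofReal (τ ^ (-δ))
      ≤ ENNReal.ofReal ((256 + 256 / (1 - δ)) * t ^ (-δ)) := by
  have hbound : ∀ τ ∈ Ioo 0 t, expKer a (t - τ) * ENNReal.ofReal (τ ^ (-δ)) ≤
      ENNReal.ofReal (2 * t ^ (-δ)) * expKer a (t - τ)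
        + ENNReal.ofReal (256 / t) * ENNReal.ofReal (τ ^ (-δ)) := by
    rintro τ ⟨hτ0, hτt⟩
    rcases le_total (t / 2) τ with h | h
    · refine le_add_right ?_
      rw [mul_comm]
      gcongr
      calc τ ^ (-δ) ≤ (t / 2) ^ (-δ) :=
            Real.rpow_le_rpow_of_nonpos (by positivity) h (by linarith)
        _ = 2 ^ δ * t ^ (-δ) := by
            rw [Real.div_rpow ht.le (by norm_num), Real.rpow_neg (by norm_num : (0:ℝ) ≤ 2)]
            field_simp
        _ ≤ 2 * t ^ (-δ) := by
            gcongr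
            calc (2:ℝ) ^ δ ≤ 2 ^ (1:ℝ) :=
                  Real.rpow_le_rpow_of_exponent_le (by norm_num) hδ1.le
              _ = 2 := by norm_num
    · refine le_add_left ?_
      gcongr
      have hr : t - τ ∈ Ioi (0:ℝ) := by simp [hτt]
      rw [expKer, indicator_of_mem hr]
      refine ENNReal.ofReal_le_ofReal ?_
      rw [le_div_iff₀ ht]
      have h1 : a / 128 * (t - τ) ≤ Real.exp (a / 128 * (t - τ)) := by
        linarith [Real.add_one_le_exp (a / 128 * (t - τ))]
      have h2 : Real.exp (-(a / 128) * (t - τ)) * Real.exp (a / 128 * (t - τ)) = 1 := by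
        rw [← Real.exp_add]; simp
      have h3 : a * t ≤ 256 * (a / 128 * (t - τ)) := by nlinarith
      calc a * Real.exp (-(a / 128) * (t - τ)) * t
          = Real.exp (-(a / 128) * (t - τ)) * (a * t) := by ring
        _ ≤ Real.exp (-(a / 128) * (t - τ)) * (256 * Real.exp (a / 128 * (t - τ))) := by
            gcongr ?_ * ?_; linarith
        _ = 256 := by rw [mul_left_comm, h2]; norm_num
  have hker : Measurable fun τ => expKer a (t - τ) :=
    measurable_expKer.comp (by fun_prop : Measurable fun τ : ℝ => (a, t - τ))
  have hpow : ∫⁻ τ in Ioo 0 t, ENNReal.ofReal (τ ^ (-δ))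
      = ENNReal.ofReal (t ^ (1 - δ) / (1 - δ)) := by
    rw [← ofReal_integral_eq_lintegral_ofReal, ← integral_Ioc_eq_integral_Ioo,
      ← intervalIntegral.integral_of_le ht.le, integral_rpow (Or.inl (by linarith))]
    · rw [Real.zero_rpow (by linarith)]
      congr 1
      rw [sub_zero, neg_add_eq_sub]
    · exact ((intervalIntegral.intervalIntegrable_rpow' (a := 0) (b := t)
        (by linarith : -1 < -δ)).1).mono_set Ioo_subset_Ioc_self
    · exact (ae_restrict_mem measurableSet_Ioo).mono fun τ hτ => Real.rpow_nonneg hτ.1.le _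
  calc ∫⁻ τ in Ioo 0 t, expKer a (t - τ) * ENNReal.ofReal (τ ^ (-δ))
      ≤ ∫⁻ τ in Ioo 0 t, (ENNReal.ofReal (2 * t ^ (-δ)) * expKer a (t - τ)
        + ENNReal.ofReal (256 / t) * ENNReal.ofReal (τ ^ (-δ))) :=
        setLIntegral_mono' measurableSet_Ioo hbound
    _ = ENNReal.ofReal (2 * t ^ (-δ)) * (∫⁻ τ in Ioo 0 t, expKer a (t - τ))
        + ENNReal.ofReal (256 / t) * ∫⁻ τ in Ioo 0 t, ENNReal.ofReal (τ ^ (-δ)) := by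
        rw [lintegral_add_left (hker.const_mul _), lintegral_const_mul _ hker,
          lintegral_const_mul _ (by fun_prop)]
    _ ≤ ENNReal.ofReal (2 * t ^ (-δ)) * ENNReal.ofReal 128
        + ENNReal.ofReal (256 / t) * ENNReal.ofReal (t ^ (1 - δ) / (1 - δ)) := by
        rw [hpow]
        gcongr
        refine (setLIntegral_le_lintegral _ _).trans (le_of_eq ?_)
        rw [lintegral_sub_left_eq_self (fun r => expKer a r) t, lintegral_expKer ha]
    _ = _ := by
        have : 0 < 1 - δ := by linarith
        rw [← ENNReal.ofReal_mul (by positivity), ← ENNReal.ofReal_mul (by positivity),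
          ← ENNReal.ofReal_add (by positivity) (by positivity)]
        congr 1
        rw [sub_eq_add_neg 1 δ, Real.rpow_add ht, Real.rpow_one]
        field_simp
        ring

lemma two_mul_rpow_le {β z : ℝ} (hβ : β ∈ Ioc (0:ℝ) 2) (hz : 0 ≤ z) :
    (2 * z) ^ β ≤ 4 * z ^ β := by
  rw [Real.mul_rpow (by norm_num) hz]
  gcongr
  calc (2:ℝ) ^ β ≤ 2 ^ (2:ℝ) := Real.rpow_le_rpow_of_exponent_le (by norm_num) hβ.2
    _ = 4 := by norm_num

lemma add_rpow_le_four_mul {β x y : ℝ} (hβ : β ∈ Ioc (0:ℝ) 2) (hx : 0 ≤ x) (hy : 0 ≤ y) :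
    (x + y) ^ β ≤ 4 * (x ^ β + y ^ β) := by
  have hx' := Real.rpow_nonneg hx β
  have hy' := Real.rpow_nonneg hy β
  rcases le_total x y with h | h
  · linarith [Real.rpow_le_rpow (by positivity) (by linarith : x + y ≤ 2 * y) hβ.1.le, two_mul_rpow_le hβ hy]
  · linarith [Real.rpow_le_rpow (by positivity) (by linarith : x + y ≤ 2 * x) hβ.1.le, two_mul_rpow_le hβ hx]

section Kernel

variable {n : ℕ} {β : ℝ}

lemma one_le_omegaB (k ξ : En n) : 1 ≤ omegaB n β k ξ := by
  unfold omegaB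
  have := Real.rpow_nonneg (norm_nonneg k) (β / (β + 1))
  have := Real.rpow_nonneg (norm_nonneg ξ) β
  linarith

lemma omegaB_pos (k ξ : En n) : 0 < omegaB n β k ξ := zero_lt_one.trans_le (one_le_omegaB k ξ)

lemma Measurable.omegaB {X : Type*} [MeasurableSpace X] {a b : X → En n} (ha : Measurable a)
    (hb : Measurable b) : Measurable fun x => omegaB n β (a x) (b x) := by
  unfold _root_.omegaB
  fun_prop

lemma mul_rpow_le_integral (hβ : β ∈ Ioc (0:ℝ) 2) {L : ℝ} (hL : 0 ≤ L) (k ξ : En n) {p : En n}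
    (hp : p = ξ ∨ p = ξ + L • k) :
    L * (‖p‖ ^ β + (L * ‖k‖) ^ β) ≤ 64 * ∫ σ in (0:ℝ)..L, ‖ξ + σ • k‖ ^ β := by
  have hcont : Continuous fun σ : ℝ => ‖ξ + σ • k‖ ^ β :=
    (by fun_prop : Continuous fun σ : ℝ => ‖ξ + σ • k‖).rpow_const fun _ => Or.inr hβ.1.le
  have hcont' : Continuous fun σ : ℝ => ‖ξ + (σ + L / 2) • k‖ ^ β :=
    hcont.comp (continuous_id.add continuous_const)
  have hpt : ∀ σ ∈ Icc 0 (L / 2), (‖p‖ ^ β + (L * ‖k‖) ^ β) / 32 ≤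
      ‖ξ + σ • k‖ ^ β + ‖ξ + (σ + L / 2) • k‖ ^ β := by
    intro σ hσ
    set A := ‖ξ + σ • k‖
    set B := ‖ξ + (σ + L / 2) • k‖
    have hA : 0 ≤ A := norm_nonneg _
    have hB : 0 ≤ B := norm_nonneg _
    have hn : ∀ r : ℝ, 0 ≤ r → ‖r • k‖ = r * ‖k‖ := fun r hr => by
      rw [norm_smul, Real.norm_of_nonneg hr]
    have h1 : L / 2 * ‖k‖ ≤ A + B := by
      rw [← hn _ (by positivity)]
      calc ‖(L / 2) • k‖ = ‖(ξ + (σ + L / 2) • k) - (ξ + σ • k)‖ := by congr 1; module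
        _ ≤ B + A := norm_sub_le _ _
        _ = A + B := add_comm _ _
    have h2 : ‖p‖ ≤ 2 * (A + B) := by
      rcases hp with rfl | rfl
      · have : ‖p‖ ≤ A + σ * ‖k‖ := by
          rw [← hn _ hσ.1]
          calc ‖p‖ = ‖(p + σ • k) - σ • k‖ := by congr 1; module
            _ ≤ _ := norm_sub_le _ _
        nlinarith [mul_le_mul_of_nonneg_right hσ.2 (norm_nonneg k)]
      · have : ‖ξ + L • k‖ ≤ B + (L / 2 - σ) * ‖k‖ := by
          rw [← hn _ (by linarith [hσ.2])]
          calc ‖ξ + L • k‖ = ‖(ξ + (σ + L / 2) • k) + (L / 2 - σ) • k‖ := by congr 1; module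
            _ ≤ _ := norm_add_le _ _
        nlinarith [mul_nonneg hσ.1 (norm_nonneg k)]
    have h3 : (2 * (A + B)) ^ β ≤ 16 * (A ^ β + B ^ β) := by
      linarith [two_mul_rpow_le hβ (add_nonneg hA hB), add_rpow_le_four_mul hβ hA hB]
    have h4 := Real.rpow_le_rpow (norm_nonneg p) h2 hβ.1.le
    have h5 := Real.rpow_le_rpow (by positivity) (by linarith : L * ‖k‖ ≤ 2 * (A + B)) hβ.1.le
    linarith
  have hint : ∀ a b, IntervalIntegrable (fun σ : ℝ => ‖ξ + σ • k‖ ^ β) volume a b :=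
    fun a b => hcont.intervalIntegrable a b
  have hsplit : ∫ σ in (0:ℝ)..L, ‖ξ + σ • k‖ ^ β =
      ∫ σ in (0:ℝ)..L / 2, (‖ξ + σ • k‖ ^ β + ‖ξ + (σ + L / 2) • k‖ ^ β) := by
    rw [intervalIntegral.integral_add (hint _ _) (hcont'.intervalIntegrable _ _),
      intervalIntegral.integral_comp_add_right (fun σ => ‖ξ + σ • k‖ ^ β), zero_add, add_halves,
      intervalIntegral.integral_add_adjacent_intervals (hint _ _) (hint _ _)]
  have hmono := intervalIntegral.integral_mono_on (by positivity : (0:ℝ) ≤ L / 2)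
    (intervalIntegrable_const (μ := volume))
    ((hcont.add hcont').intervalIntegrable _ _) hpt
  rw [intervalIntegral.integral_const, smul_eq_mul, sub_zero] at hmono
  simp only [Pi.add_apply] at hmono
  rw [hsplit]
  linarith

lemma mul_norm_rpow_eq (hβ : 0 < β) {L : ℝ} (hL : 0 ≤ L) (k : En n) :
    (L * ‖k‖) ^ β = ‖k‖ ^ (β / (β + 1)) * (L * ‖k‖ ^ (β / (β + 1))) ^ β := by
  have hk := norm_nonneg k
  rw [Real.mul_rpow hL hk, Real.mul_rpow hL (by positivity), ← Real.rpow_mul hk, mul_left_comm,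
    ← Real.rpow_add_of_nonneg hk (by positivity) (by positivity)]
  congr 2
  field_simp
  ring

lemma eB_nonneg (t : ℝ) (k ξ : En n) : 0 ≤ eB n β t k ξ := (Real.exp_pos _).le

lemma eB_le (hβ : β ∈ Ioc (0:ℝ) 2) {L T : ℝ} (hL : 0 ≤ L) (hLT : L ≤ T) (k ξ : En n) {p : En n}
    (hp : p = ξ ∨ p = ξ + L • k) :
    eB n β L k ξ ≤ Real.exp ((T + 1) / 64) * Real.exp (-(L * omegaB n β k p / 64)) := by
  rw [eB, ← Real.exp_add, Real.exp_le_exp]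
  have h := mul_rpow_le_integral hβ hL k ξ hp
  have hl : L * ‖k‖ ^ (β / (β + 1)) ≤ 1 + L * (L * ‖k‖) ^ β := by
    rw [mul_norm_rpow_eq hβ.1 hL, ← mul_assoc]
    set x := L * ‖k‖ ^ (β / (β + 1))
    have hx : 0 ≤ x := by positivity
    rcases le_total x 1 with h1 | h1
    · have : 0 ≤ x * x ^ β := by positivity
      linarith
    · nlinarith [Real.one_le_rpow h1 hβ.1.le]
  unfold omegaB
  linarith

lemma omegaB_le_mul (hβ : β ∈ Ioc (0:ℝ) 2) {L : ℝ} (hL : 0 ≤ L) {k p q : En n}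
    (hpq : ‖p‖ ≤ ‖q‖ + L * ‖k‖) :
    omegaB n β k p ≤ 8 * (1 + L * ‖k‖ ^ (β / (β + 1))) ^ 2 * omegaB n β k q := by
  have h1 : ‖p‖ ^ β ≤ 4 * (‖q‖ ^ β + (L * ‖k‖) ^ β) :=
    (Real.rpow_le_rpow (norm_nonneg _) hpq hβ.1.le).trans
      (add_rpow_le_four_mul hβ (norm_nonneg _) (by positivity))
  rw [mul_norm_rpow_eq hβ.1 hL] at h1
  unfold omegaB
  set l := ‖k‖ ^ (β / (β + 1))
  have hl : 0 ≤ l := by positivity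
  set x := L * l
  have hx : 0 ≤ x := by positivity
  have hq : 0 ≤ ‖q‖ ^ β := by positivity
  have h2 : x ^ β ≤ (1 + x) ^ 2 := by
    calc x ^ β ≤ (1 + x) ^ β := Real.rpow_le_rpow hx (by linarith) hβ.1.le
      _ ≤ (1 + x) ^ (2:ℝ) := Real.rpow_le_rpow_of_exponent_le (by linarith) hβ.2
      _ = (1 + x) ^ 2 := by norm_num
  have h3 : 1 ≤ (1 + x) ^ 2 := by nlinarith
  nlinarith [mul_le_mul_of_nonneg_left h2 hl, mul_le_mul_of_nonneg_right h3 hq,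
    mul_le_mul_of_nonneg_right h3 hl]

lemma rpow_mul_exp_le {m x : ℝ} (hm : 0 ≤ m) (hx : 0 ≤ x) :
    (8 * (1 + x) ^ 2) ^ m * Real.exp (-(x / 64)) ≤
      (8 * (256 * m + 1) ^ 2) ^ m * Real.exp (-(x / 128)) := by
  set N := 256 * m + 1 with hN
  have hN1 : 1 ≤ N := by linarith
  have hN0 : 0 < N := by linarith
  have h1 : 1 + x ≤ N * Real.exp (x / N) := by
    have : x / N + 1 ≤ Real.exp (x / N) := Real.add_one_le_exp _
    calc 1 + x ≤ N + x := by linarith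
      _ = N * (x / N + 1) := by field_simp; ring
      _ ≤ _ := by gcongr
  have h2 : (8 * (1 + x) ^ 2) ^ m ≤ (8 * N ^ 2) ^ m * Real.exp (x / 128) := by
    calc (8 * (1 + x) ^ 2) ^ m ≤ (8 * (N * Real.exp (x / N)) ^ 2) ^ m := by gcongr
      _ = (8 * N ^ 2) ^ m * Real.exp (2 * m * x / N) := by
        rw [mul_pow, ← mul_assoc, Real.mul_rpow (by positivity) (by positivity),
          ← Real.exp_nat_mul, ← Real.exp_mul]
        congr 2
        push_cast
        ring
      _ ≤ _ := by
        gcongr _ * Real.exp ?_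
        rw [div_le_div_iff₀ hN0 (by norm_num)]
        nlinarith
  calc (8 * (1 + x) ^ 2) ^ m * Real.exp (-(x / 64))
      ≤ (8 * N ^ 2) ^ m * Real.exp (x / 128) * Real.exp (-(x / 64)) := by gcongr
    _ = _ := by rw [mul_assoc, ← Real.exp_add]; congr 2; ring

lemma rpow_le_rpow_abs {r Q s m : ℝ} (hr : 0 < r) (hQ : 1 ≤ Q) (h1 : r ≤ Q) (h2 : r⁻¹ ≤ Q)
    (hs : |s| ≤ m) : r ^ s ≤ Q ^ m := by
  have h : r ^ s ≤ Q ^ |s| := by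
    rcases le_total 0 s with h | h
    · rw [abs_of_nonneg h]
      exact Real.rpow_le_rpow hr.le h1 h
    · rw [abs_of_nonpos h]
      calc r ^ s = (r⁻¹) ^ (-s) := by rw [Real.inv_rpow hr.le, Real.rpow_neg hr.le, inv_inv]
        _ ≤ _ := Real.rpow_le_rpow (by positivity) h2 (by linarith)
  exact h.trans (Real.rpow_le_rpow_of_exponent_le hQ hs)

/-- The constant in the pointwise kernel bound. -/
def kerConst (s T : ℝ) : ℝ :=
  Real.exp ((T + 1) / 64) * (8 * (256 * (|s| + 1) + 1) ^ 2) ^ (|s| + 1)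

lemma kerConst_pos (s T : ℝ) : 0 < kerConst s T := by unfold kerConst; positivity

lemma weighted_eB_le (hβ : β ∈ Ioc (0:ℝ) 2) (s : ℝ) {L T : ℝ} (hL : 0 ≤ L) (hLT : L ≤ T)
    (k ξ : En n) {p : En n} (hp : p = ξ ∨ p = ξ + L • k) :
    omegaB n β k ξ ^ (s + 1) * omegaB n β k (ξ + L • k) ^ (-s) * eB n β L k ξ ≤
      kerConst s T * (omegaB n β k p * Real.exp (-(omegaB n β k p / 128) * L)) := by
  have ha := omegaB_pos (β := β) k ξ
  have hb := omegaB_pos (β := β) k (ξ + L • k)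
  have hnk : ‖L • k‖ = L * ‖k‖ := by rw [norm_smul, Real.norm_of_nonneg hL]
  have hab := omegaB_le_mul hβ hL (k := k) (p := ξ) (q := ξ + L • k) (by
    rw [← hnk]; simpa using norm_sub_le (ξ + L • k) (L • k))
  have hba := omegaB_le_mul hβ hL (k := k) (p := ξ + L • k) (q := ξ) (by
    rw [← hnk]; exact norm_add_le _ _)
  have hx1 : L * ‖k‖ ^ (β / (β + 1)) ≤ L * omegaB n β k p := by
    gcongr
    unfold omegaB
    linarith [Real.rpow_nonneg (norm_nonneg p) β]
  have hp0 := omegaB_pos (β := β) k p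
  have he0 := eB_nonneg (β := β) L k ξ
  have he := eB_le hβ hL hLT k ξ hp
  set a := omegaB n β k ξ
  set b := omegaB n β k (ξ + L • k)
  set w := omegaB n β k p with hw
  set x := L * w with hx
  have hx0 : 0 ≤ x := by positivity
  have hl0 : 0 ≤ L * ‖k‖ ^ (β / (β + 1)) := by positivity
  set Q := 8 * (1 + x) ^ 2 with hQ
  have hQ1 : 1 ≤ Q := by nlinarith
  have hQle : 8 * (1 + L * ‖k‖ ^ (β / (β + 1))) ^ 2 ≤ Q := by
    rw [hQ]; gcongr
  have hr1 : a / b ≤ Q := by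
    rw [div_le_iff₀ hb]
    exact hab.trans (by gcongr)
  have hr2 : (a / b)⁻¹ ≤ Q := by
    rw [inv_div, div_le_iff₀ ha]
    exact hba.trans (by gcongr)
  have hfac : a ^ (s + 1) * b ^ (-s) ≤ w * Q ^ (|s| + 1) := by
    rcases hp with h | h
    · have : w = a := by rw [hw, h]
      rw [this, Real.rpow_add ha, Real.rpow_one, Real.rpow_neg hb.le]
      calc a ^ s * a * (b ^ s)⁻¹ = a * (a / b) ^ s := by
            rw [Real.div_rpow ha.le hb.le]; ring
        _ ≤ _ := by
            gcongr
            exact rpow_le_rpow_abs (by positivity) hQ1 hr1 hr2 (by linarith)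
    · have : w = b := by rw [hw, h]
      rw [this]
      calc a ^ (s + 1) * b ^ (-s) = b * (a / b) ^ (s + 1) := by
            rw [Real.div_rpow ha.le hb.le, Real.rpow_add hb, Real.rpow_one, Real.rpow_neg hb.le]
            field_simp
        _ ≤ _ := by
            gcongr
            exact rpow_le_rpow_abs (by positivity) hQ1 hr1 hr2
              ((abs_add_le s 1).trans (by simp))
  calc a ^ (s + 1) * b ^ (-s) * eB n β L k ξ
      ≤ w * Q ^ (|s| + 1) * (Real.exp ((T + 1) / 64) * Real.exp (-(x / 64))) := by gcongr
    _ = Real.exp ((T + 1) / 64) * w * (Q ^ (|s| + 1) * Real.exp (-(x / 64))) := by ring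
    _ ≤ Real.exp ((T + 1) / 64) * w *
        ((8 * (256 * (|s| + 1) + 1) ^ 2) ^ (|s| + 1) * Real.exp (-(x / 128))) := by
        gcongr _ * ?_
        exact rpow_mul_exp_le (by positivity) hx0
    _ = kerConst s T * (w * Real.exp (-(w / 128) * L)) := by
        rw [kerConst, hx, show -(w / 128) * L = -(L * w / 128) by ring]
        ring

end Kernel

lemma sq_le_mul_of_weighted_le {a b c e s x A B τ δ : ℝ} (ha : 0 < a) (hb : 0 < b)
    (hτ : 0 < τ) (he : 0 ≤ e) (h1 : a ^ (s + 1) * b ^ (-s) * e ≤ c * A)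
    (h2 : a ^ (s + 1) * b ^ (-s) * e ≤ c * B) :
    (a ^ (s + 1) * (x * e)) ^ 2 ≤
      c * (A * τ ^ (-δ)) * (c * (B * (τ ^ δ * b ^ (2 * s) * x ^ 2))) := by
  have hcA : 0 ≤ c * A := le_trans (by positivity) h1
  have hbs : b ^ (2 * s) = (b ^ s) ^ 2 := by
    rw [mul_comm, Real.rpow_mul hb.le, Real.rpow_two]
  have hcancel : b ^ (-s) * b ^ s = 1 := by rw [← Real.rpow_add hb]; simp
  have hcancel' : τ ^ (-δ) * τ ^ δ = 1 := by rw [← Real.rpow_add hτ]; simp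
  calc (a ^ (s + 1) * (x * e)) ^ 2
      = (a ^ (s + 1) * b ^ (-s) * e) * (a ^ (s + 1) * b ^ (-s) * e) *
          ((b ^ s) ^ 2 * x ^ 2) := by
        calc (a ^ (s + 1) * (x * e)) ^ 2
            = (a ^ (s + 1) * (x * e)) ^ 2 * (b ^ (-s) * b ^ s) ^ 2 := by
              rw [hcancel]; ring
          _ = _ := by ring
    _ ≤ c * A * (c * B) * ((b ^ s) ^ 2 * x ^ 2) := by gcongr
    _ = c * A * (c * B) * ((b ^ s) ^ 2 * x ^ 2) * (τ ^ (-δ) * τ ^ δ) := by rw [hcancel', mul_one]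
    _ = _ := by rw [hbs]; ring

/-- The weighted Duhamel integral at a point is controlled by a transported convolution. -/
lemma weighted_duhamel_le {n : ℕ} {β s δ t T : ℝ} (hβ : β ∈ Ioc (0:ℝ) 2) (hδ0 : 0 ≤ δ)
    (hδ1 : δ < 1) (ht : t ∈ Ioo 0 T) (k ξ : En n) {f : ℝ → ℂ} (hf : Measurable f) :
    ENNReal.ofReal (t ^ δ * omegaB n β k ξ ^ (2 * (s + 1)) *
        ‖∫ τ in (0:ℝ)..t, f τ * (eB n β (t - τ) k ξ : ℂ)‖ ^ 2) ≤
      ENNReal.ofReal (kerConst s T ^ 2 * (256 + 256 / (1 - δ))) *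
        ∫⁻ τ in Ioo 0 t, expKer (omegaB n β k (ξ + (t - τ) • k)) (t - τ) *
          ENNReal.ofReal (τ ^ δ * omegaB n β k (ξ + (t - τ) • k) ^ (2 * s) * ‖f τ‖ ^ 2) := by
  have ha : 0 < omegaB n β k ξ := omegaB_pos k ξ
  have hω : Measurable fun τ : ℝ => omegaB n β k (ξ + (t - τ) • k) :=
    Measurable.omegaB (by fun_prop) (by fun_prop)
  have hsub : Measurable fun τ : ℝ => t - τ := by fun_prop
  have hg : Measurable fun τ => expKer (omegaB n β k ξ) (t - τ) * ENNReal.ofReal (τ ^ (-δ)) :=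
    (measurable_expKer.comp (measurable_const.prodMk hsub)).mul (by fun_prop)
  have hh : Measurable fun τ => expKer (omegaB n β k (ξ + (t - τ) • k)) (t - τ) *
      ENNReal.ofReal (τ ^ δ * omegaB n β k (ξ + (t - τ) • k) ^ (2 * s) * ‖f τ‖ ^ 2) :=
    (measurable_expKer.comp (hω.prodMk hsub)).mul (by fun_prop)
  set I := ∫ τ in (0:ℝ)..t, f τ * (eB n β (t - τ) k ξ : ℂ) with hI
  have hIle : ENNReal.ofReal (omegaB n β k ξ ^ (s + 1)) * ‖I‖ₑ ≤
      ∫⁻ τ in Ioo 0 t, ENNReal.ofReal (omegaB n β k ξ ^ (s + 1) * (‖f τ‖ * eB n β (t - τ) k ξ)) := by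
    rw [hI, intervalIntegral.integral_of_le ht.1.le, integral_Ioc_eq_integral_Ioo]
    calc ENNReal.ofReal (omegaB n β k ξ ^ (s + 1)) *
          ‖∫ τ in Ioo 0 t, f τ * (eB n β (t - τ) k ξ : ℂ)‖ₑ
        ≤ ENNReal.ofReal (omegaB n β k ξ ^ (s + 1)) *
          ∫⁻ τ in Ioo 0 t, ‖f τ * (eB n β (t - τ) k ξ : ℂ)‖ₑ := by
          gcongr
          exact enorm_integral_le_lintegral_enorm _
      _ = ∫⁻ τ in Ioo 0 t, ENNReal.ofReal (omegaB n β k ξ ^ (s + 1)) *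
          ‖f τ * (eB n β (t - τ) k ξ : ℂ)‖ₑ :=
          (lintegral_const_mul' _ _ ENNReal.ofReal_ne_top).symm
      _ = _ := by
        refine lintegral_congr fun τ => ?_
        rw [← ofReal_norm, ← ENNReal.ofReal_mul (by positivity), norm_mul,
          Complex.norm_real, Real.norm_of_nonneg (eB_nonneg _ _ _)]
  have hC := kerConst_pos s T
  have hCS := sq_lintegral_le_mul (ν := volume.restrict (Ioo 0 t))
    (f := fun τ => ENNReal.ofReal (omegaB n β k ξ ^ (s + 1) * (‖f τ‖ * eB n β (t - τ) k ξ)))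
    (hg.const_mul (ENNReal.ofReal (kerConst s T))).aemeasurable
    (hh.const_mul (ENNReal.ofReal (kerConst s T))).aemeasurable
    ((ae_restrict_mem measurableSet_Ioo).mono fun τ hτ => by
      have hr : t - τ ∈ Ioi (0:ℝ) := by simp [hτ.2]
      have hrT : t - τ ≤ T := by linarith [hτ.1, ht.2]
      have hb : 0 < omegaB n β k (ξ + (t - τ) • k) := omegaB_pos k _
      have h1 := weighted_eB_le hβ s (le_of_lt hr) hrT k ξ (Or.inl rfl)
      have h2 := weighted_eB_le hβ s (le_of_lt hr) hrT k ξ (Or.inr rfl)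
      have he := eB_nonneg (β := β) (t - τ) k ξ
      have hτδ : 0 < τ ^ δ := Real.rpow_pos_of_pos hτ.1 _
      have hτδ' : 0 < τ ^ (-δ) := Real.rpow_pos_of_pos hτ.1 _
      simp only [expKer, indicator_of_mem hr]
      set a := omegaB n β k ξ
      set b := omegaB n β k (ξ + (t - τ) • k)
      set e := eB n β (t - τ) k ξ
      rw [← ENNReal.ofReal_mul (by positivity), ← ENNReal.ofReal_mul (by positivity),
        ← ENNReal.ofReal_mul (by positivity), ← ENNReal.ofReal_mul (by positivity),
        ← ENNReal.ofReal_mul (by positivity), ← ENNReal.ofReal_pow (by positivity)]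
      refine ENNReal.ofReal_le_ofReal ?_
      exact sq_le_mul_of_weighted_le ha hb hτ.1 he h1 h2)
  rw [lintegral_const_mul _ hg, lintegral_const_mul _ hh] at hCS
  have ht0 : 0 < t := ht.1
  have h1δ : 0 < 1 - δ := by linarith
  set H := ∫⁻ τ in Ioo 0 t, expKer (omegaB n β k (ξ + (t - τ) • k)) (t - τ) *
    ENNReal.ofReal (τ ^ δ * omegaB n β k (ξ + (t - τ) • k) ^ (2 * s) * ‖f τ‖ ^ 2)
  calc ENNReal.ofReal (t ^ δ * omegaB n β k ξ ^ (2 * (s + 1)) * ‖I‖ ^ 2)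
      = ENNReal.ofReal (t ^ δ) * (ENNReal.ofReal (omegaB n β k ξ ^ (s + 1)) * ‖I‖ₑ) ^ 2 := by
        rw [← ofReal_norm, ← ENNReal.ofReal_mul (by positivity),
          ← ENNReal.ofReal_pow (by positivity), ← ENNReal.ofReal_mul (by positivity), mul_pow,
          mul_comm 2 (s + 1), Real.rpow_mul ha.le, Real.rpow_two, mul_assoc]
    _ ≤ ENNReal.ofReal (t ^ δ) * (ENNReal.ofReal (kerConst s T) *
          ENNReal.ofReal ((256 + 256 / (1 - δ)) * t ^ (-δ)) *
          (ENNReal.ofReal (kerConst s T) * H)) := by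
        gcongr ENNReal.ofReal (t ^ δ) * ?_
        refine (pow_le_pow_left' hIle 2).trans (hCS.trans ?_)
        gcongr _ * ?_ * _
        exact lintegral_expKer_mul_rpow_le ha ht.1 hδ0 hδ1
    _ = ENNReal.ofReal (t ^ δ) * ENNReal.ofReal (kerConst s T) *
          ENNReal.ofReal ((256 + 256 / (1 - δ)) * t ^ (-δ)) * ENNReal.ofReal (kerConst s T) * H := by
        ring
    _ = ENNReal.ofReal (kerConst s T ^ 2 * (256 + 256 / (1 - δ))) * H := by
        have hcancel : t ^ δ * t ^ (-δ) = 1 := by rw [← Real.rpow_add ht.1]; simp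
        rw [← ENNReal.ofReal_mul (by positivity), ← ENNReal.ofReal_mul (by positivity),
          ← ENNReal.ofReal_mul (by positivity)]
        congr 2
        linear_combination (kerConst s T ^ 2 * (256 + 256 / (1 - δ))) * hcancel

theorem stmt2 (n : ℕ) (hn : 1 ≤ n) (β s μ T : ℝ) (hβ : β ∈ Ioc (0:ℝ) 2)
    (hs : -(1/2 : ℝ) ≤ s) (hμ : μ ∈ Ioc (1/2 : ℝ) 1) (hT : 0 < T) :
    ∃ c : ℝ, 0 < c ∧ ∀ F : ℝ → En n → En n → ℂ,
      Measurable (fun p : ℝ × En n × En n => F p.1 p.2.1 p.2.2) →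
      (∫⁻ t in Ioo (0:ℝ) T, ∫⁻ (k : En n), ∫⁻ (ξ : En n),
          ENNReal.ofReal (t ^ (2 - 2*μ) * omegaB n β k ξ ^ (2 * s) * ‖F t k ξ‖ ^ 2)) < ⊤ →
      (∫⁻ t in Ioo (0:ℝ) T, ∫⁻ (k : En n), ∫⁻ (ξ : En n),
          ENNReal.ofReal (t ^ (2 - 2*μ) * omegaB n β k ξ ^ (2 * (s + 1)) *
            ‖∫ τ in (0:ℝ)..t, F τ k (ξ + (t - τ) • k) * (eB n β (t - τ) k ξ : ℂ)‖ ^ 2))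
        ≤ ENNReal.ofReal c *
          ∫⁻ t in Ioo (0:ℝ) T, ∫⁻ (k : En n), ∫⁻ (ξ : En n),
            ENNReal.ofReal (t ^ (2 - 2*μ) * omegaB n β k ξ ^ (2 * s) * ‖F t k ξ‖ ^ 2) := by
  have hδ0 : 0 ≤ 2 - 2 * μ := by linarith [hμ.2]
  have hδ1 : 2 - 2 * μ < 1 := by linarith [hμ.1]
  have h1δ : 0 < 1 - (2 - 2 * μ) := by linarith
  set δ := 2 - 2 * μ
  have hC := kerConst_pos s T
  refine ⟨kerConst s T ^ 2 * (256 + 256 / (1 - δ)) * 128, by positivity, fun F hF _ => ?_⟩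
  have hω : Measurable fun p : ℝ × En n × En n => omegaB n β p.2.1 p.2.2 :=
    Measurable.omegaB (by fun_prop) (by fun_prop)
  set Φ : ℝ → En n → En n → ℝ≥0∞ := fun τ k ξ => (Ioo 0 T).indicator
    (fun τ => ENNReal.ofReal (τ ^ δ * omegaB n β k ξ ^ (2 * s) * ‖F τ k ξ‖ ^ 2)) τ with hΦdef
  have hΦ : Measurable fun p : ℝ × En n × En n => Φ p.1 p.2.1 p.2.2 := by
    have : (fun p : ℝ × En n × En n => Φ p.1 p.2.1 p.2.2) = (Prod.fst ⁻¹' Ioo 0 T).indicator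
        (fun p => ENNReal.ofReal (p.1 ^ δ * omegaB n β p.2.1 p.2.2 ^ (2 * s) *
          ‖F p.1 p.2.1 p.2.2‖ ^ 2)) := by
      ext p
      simp only [hΦdef, indicator, mem_preimage]
    rw [this]
    exact Measurable.indicator (by fun_prop) (measurable_fst measurableSet_Ioo)
  have hK : Measurable fun p : ℝ × En n × En n => expKer (omegaB n β p.2.1 p.2.2) p.1 :=
    measurable_expKer.comp (hω.prodMk measurable_fst)
  have hΦint : ∫⁻ τ, ∫⁻ k, ∫⁻ ξ, Φ τ k ξ = ∫⁻ t in Ioo (0:ℝ) T, ∫⁻ (k : En n), ∫⁻ (ξ : En n),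
      ENNReal.ofReal (t ^ δ * omegaB n β k ξ ^ (2 * s) * ‖F t k ξ‖ ^ 2) := by
    rw [← lintegral_indicator measurableSet_Ioo]
    refine lintegral_congr fun τ => ?_
    by_cases hτ : τ ∈ Ioo 0 T <;> simp [hΦdef, hτ]
  set C := kerConst s T ^ 2 * (256 + 256 / (1 - δ))
  have hpt : ∀ t ∈ Ioo 0 T, ∀ k ξ, ENNReal.ofReal (t ^ δ * omegaB n β k ξ ^ (2 * (s + 1)) *
      ‖∫ τ in (0:ℝ)..t, F τ k (ξ + (t - τ) • k) * (eB n β (t - τ) k ξ : ℂ)‖ ^ 2) ≤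
      ENNReal.ofReal C * ∫⁻ τ, expKer (omegaB n β k (ξ + (t - τ) • k)) (t - τ) *
        Φ τ k (ξ + (t - τ) • k) := fun t ht k ξ => by
    refine (weighted_duhamel_le hβ hδ0 hδ1 ht k ξ
      (hF.comp (by fun_prop : Measurable fun τ : ℝ => (τ, k, ξ + (t - τ) • k)))).trans ?_
    gcongr ENNReal.ofReal C * ?_
    refine le_trans (le_of_eq ?_) (setLIntegral_le_lintegral (Ioo 0 t) _)
    refine setLIntegral_congr_fun measurableSet_Ioo fun τ hτ => ?_
    have : τ ∈ Ioo 0 T := ⟨hτ.1, hτ.2.trans ht.2⟩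
    simp only [hΦdef, indicator_of_mem this, Function.comp_apply]
  calc _ ≤ ∫⁻ t in Ioo (0:ℝ) T, ∫⁻ k : En n, ∫⁻ ξ : En n, ENNReal.ofReal C *
        ∫⁻ τ, expKer (omegaB n β k (ξ + (t - τ) • k)) (t - τ) * Φ τ k (ξ + (t - τ) • k) :=
        setLIntegral_mono' measurableSet_Ioo fun t ht =>
          lintegral_mono fun k => lintegral_mono fun ξ => hpt t ht k ξ
    _ ≤ ∫⁻ t : ℝ, ∫⁻ k : En n, ∫⁻ ξ : En n, ENNReal.ofReal C *
        ∫⁻ τ, expKer (omegaB n β k (ξ + (t - τ) • k)) (t - τ) * Φ τ k (ξ + (t - τ) • k) :=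
        setLIntegral_le_lintegral _ _
    _ = ENNReal.ofReal C * ∫⁻ t : ℝ, ∫⁻ k : En n, ∫⁻ ξ : En n,
        ∫⁻ τ, expKer (omegaB n β k (ξ + (t - τ) • k)) (t - τ) * Φ τ k (ξ + (t - τ) • k) := by
        simp_rw [lintegral_const_mul' _ _ ENNReal.ofReal_ne_top]
    _ ≤ ENNReal.ofReal C * (ENNReal.ofReal 128 * ∫⁻ τ, ∫⁻ k, ∫⁻ ξ, Φ τ k ξ) := by
        gcongr
        exact lintegral_transport_le (K := fun r k ξ => expKer (omegaB n β k ξ) r) hK hΦ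
          fun k ξ => (lintegral_expKer (omegaB_pos k ξ)).le
    _ = _ := by
        rw [hΦint, ← mul_assoc, ← ENNReal.ofReal_mul (by positivity)]
end
end

section
/- Let T ∈ (0,∞) and μ ∈ (1/2,1]. Suppose u ∈ L²_μ((0,T); L²(ℝ^{2n})) is such that its distributional transport derivative h := ∂_t u + v·∇_x u also belongs to L²_μ((0,T); L²(ℝ^{2n})), i.e. for all φ ∈ C_c^∞((0,T)×ℝ^{2n}): −∫ u (∂_t φ + v·∇_x φ) dt dx dv = ∫ h φ dt dx dv. Then the function Γu defined by [Γu](t,x,v) = u(t, x+tv, v) belongs to L²_μ((0,T); L²(ℝ^{2n})), its distributional time derivative satisfies ∂_t(Γu) = Γh (that is, −∫ Γu · ∂_t φ dt dx dv = ∫ (Γh) φ dt dx dv for all φ ∈ C_c^∞((0,T)×ℝ^{2n})), and Γ is an isomorphism from the space of such u (normed by ‖u‖_{L²_μ(L²)} + ‖h‖_{L²_μ(L²)}) onto H¹_μ((0,T); L²(ℝ^{2n})) = {w ∈ L²_μ((0,T);L²(ℝ^{2n})) : ∂_t w ∈ L²_μ((0,T);L²(ℝ^{2n}))}. -/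
open MeasureTheory Set Filter
open scoped ENNReal

noncomputable section

/-- `h = ∂_t u + v·∇ₓ u` in the sense of distributions on `(0,T) × ℝ^{2n}`,
where a point of `ℝ^{2n}` is written `q = (x, v)`. -/
def IsTransportDeriv (n : ℕ) (T : ℝ) (u h : ℝ → En n × En n → ℂ) : Prop :=
  ∀ φ : ℝ × (En n × En n) → ℝ, ContDiff ℝ ((⊤ : ℕ∞) : WithTop ℕ∞) φ → HasCompactSupport φ →
    (∀ p : ℝ × (En n × En n), p.1 ∉ Ioo 0 T → φ p = 0) →
    -(∫ t in Ioo 0 T, ∫ q : En n × En n,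
        u t q * (fderiv ℝ φ (t, q) ((1 : ℝ), (q.2, (0 : En n))) : ℂ))
      = ∫ t in Ioo 0 T, ∫ q : En n × En n, h t q * (φ (t, q) : ℂ)

/-- `w' = ∂_t w` in the sense of distributions on `(0,T) × ℝ^{2n}`. -/
def IsTimeDeriv (n : ℕ) (T : ℝ) (w w' : ℝ → En n × En n → ℂ) : Prop :=
  ∀ φ : ℝ × (En n × En n) → ℝ, ContDiff ℝ ((⊤ : ℕ∞) : WithTop ℕ∞) φ → HasCompactSupport φ →
    (∀ p : ℝ × (En n × En n), p.1 ∉ Ioo 0 T → φ p = 0) →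
    -(∫ t in Ioo 0 T, ∫ q : En n × En n,
        w t q * (fderiv ℝ φ (t, q) ((1 : ℝ), (0 : En n × En n)) : ℂ))
      = ∫ t in Ioo 0 T, ∫ q : En n × En n, w' t q * (φ (t, q) : ℂ)

/-- Squared norm of `L²_μ((0,T); L²(ℝ^{2n}))`. -/
def L2mu (n : ℕ) (T μ : ℝ) (u : ℝ → En n × En n → ℂ) : ℝ≥0∞ :=
  ∫⁻ t in Ioo 0 T, ∫⁻ q : En n × En n, ENNReal.ofReal (t ^ (2 - 2*μ) * ‖u t q‖ ^ 2)

section Shear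

variable {E : Type*} [NormedAddCommGroup E] [NormedSpace ℝ E]

/-- The free transport `(x, v) ↦ (x + s v, v)` of phase space, as a homeomorphism. -/
def shear (s : ℝ) : E × E ≃ₜ E × E where
  toFun q := (q.1 + s • q.2, q.2)
  invFun q := (q.1 + (-s) • q.2, q.2)
  left_inv q := by simp
  right_inv q := by simp
  continuous_toFun := by fun_prop
  continuous_invFun := by fun_prop

theorem shear_apply (s : ℝ) (q : E × E) : shear s q = (q.1 + s • q.2, q.2) := rfl

theorem shear_snd (s : ℝ) (q : E × E) : (shear s q).2 = q.2 := rfl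

theorem shear_neg_shear (s : ℝ) (q : E × E) : shear (-s) (shear s q) = q :=
  (shear s).left_inv q

theorem measurePreserving_shear [MeasureSpace E] [BorelSpace E] [SecondCountableTopology E]
    [SFinite (volume : Measure E)] [(volume : Measure E).IsAddLeftInvariant] (s : ℝ) :
    MeasurePreserving (shear (E := E) s) := by
  have hskew : MeasurePreserving (fun p : E × E => (p.1, s • p.1 + p.2))
      (volume.prod volume) (volume.prod volume) :=
    (MeasurePreserving.id volume).skew_product (g := fun v x => s • v + x)
      (by fun_prop)
      (Eventually.of_forall fun v => map_add_left_eq_self volume (s • v))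
  have h := (Measure.measurePreserving_swap.comp hskew).comp
    (Measure.measurePreserving_swap (μ := (volume : Measure E)) (ν := (volume : Measure E)))
  have hcomp : (Prod.swap ∘ fun p : E × E => (p.1, s • p.1 + p.2)) ∘ Prod.swap = shear s := by
    ext1 q
    simp [shear_apply, add_comm]
  exact hcomp ▸ h

/-- The map `(t, x, v) ↦ (t, x + b t v, v)` of space-time, as a homeomorphism. -/
def spaceTimeShear (b : ℝ) : ℝ × (E × E) ≃ₜ ℝ × (E × E) where
  toFun p := (p.1, shear (b * p.1) p.2)
  invFun p := (p.1, shear (-(b * p.1)) p.2)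
  left_inv p := by simp [shear_apply]
  right_inv p := by simp [shear_apply]
  continuous_toFun := by simp only [shear_apply]; fun_prop
  continuous_invFun := by simp only [shear_apply]; fun_prop

theorem spaceTimeShear_apply (b : ℝ) (p : ℝ × (E × E)) :
    spaceTimeShear b p = (p.1, shear (b * p.1) p.2) := rfl

theorem contDiff_spaceTimeShear (b : ℝ) {k : WithTop ℕ∞} :
    ContDiff ℝ k (spaceTimeShear (E := E) b) := by
  simp only [funext (spaceTimeShear_apply (E := E) b), shear_apply]
  fun_prop

theorem fderiv_spaceTimeShear_transport (a b t : ℝ) (q : E × E) :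
    fderiv ℝ (spaceTimeShear b) (t, q) ((1 : ℝ), (a • q.2, (0 : E)))
      = ((1 : ℝ), ((a + b) • q.2, (0 : E))) := by
  have hv : HasFDerivAt (fun p : ℝ × (E × E) => p.2.2)
      ((ContinuousLinearMap.snd ℝ E E).comp (ContinuousLinearMap.snd ℝ ℝ (E × E))) (t, q) :=
    ((ContinuousLinearMap.snd ℝ E E).comp (ContinuousLinearMap.snd ℝ ℝ (E × E))).hasFDerivAt
  have hx : HasFDerivAt (fun p : ℝ × (E × E) => p.2.1)
      ((ContinuousLinearMap.fst ℝ E E).comp (ContinuousLinearMap.snd ℝ ℝ (E × E))) (t, q) :=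
    ((ContinuousLinearMap.fst ℝ E E).comp (ContinuousLinearMap.snd ℝ ℝ (E × E))).hasFDerivAt
  have ht : HasFDerivAt (fun p : ℝ × (E × E) => p.1)
      (ContinuousLinearMap.fst ℝ ℝ (E × E)) (t, q) := hasFDerivAt_fst
  have h := ht.prodMk ((hx.add ((ht.const_mul b).smul hv)).prodMk hv)
  have h' : HasFDerivAt (spaceTimeShear (E := E) b) _ (t, q) := h
  rw [h'.fderiv]
  simp [add_smul]

end Shear

/-- `h = ∂_t u + a v·∇ₓ u` in the sense of distributions on `(0,T) × ℝ^{2n}`. -/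
def IsScaledTransportDeriv (n : ℕ) (T a : ℝ) (u h : ℝ → En n × En n → ℂ) : Prop :=
  ∀ φ : ℝ × (En n × En n) → ℝ, ContDiff ℝ ((⊤ : ℕ∞) : WithTop ℕ∞) φ → HasCompactSupport φ →
    (∀ p : ℝ × (En n × En n), p.1 ∉ Ioo 0 T → φ p = 0) →
    -(∫ t in Ioo 0 T, ∫ q : En n × En n,
        u t q * (fderiv ℝ φ (t, q) ((1 : ℝ), (a • q.2, (0 : En n))) : ℂ))
      = ∫ t in Ioo 0 T, ∫ q : En n × En n, h t q * (φ (t, q) : ℂ)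

theorem isScaledTransportDeriv_one {n : ℕ} {T : ℝ} {u h : ℝ → En n × En n → ℂ} :
    IsScaledTransportDeriv n T 1 u h ↔ IsTransportDeriv n T u h := by
  simp only [IsScaledTransportDeriv, IsTransportDeriv, one_smul]

theorem isScaledTransportDeriv_zero {n : ℕ} {T : ℝ} {u h : ℝ → En n × En n → ℂ} :
    IsScaledTransportDeriv n T 0 u h ↔ IsTimeDeriv n T u h := by
  simp only [IsScaledTransportDeriv, IsTimeDeriv, zero_smul, Prod.mk_zero_zero]

theorem IsScaledTransportDeriv.comp_shear {n : ℕ} {T a : ℝ} {u h : ℝ → En n × En n → ℂ}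
    (huh : IsScaledTransportDeriv n T a u h) (b : ℝ) :
    IsScaledTransportDeriv n T (a - b) (fun t q => u t (shear (b * t) q))
      (fun t q => h t (shear (b * t) q)) := by
  intro φ hφ hsupp hvanish
  have key := huh (φ ∘ spaceTimeShear (-b)) (hφ.comp (contDiff_spaceTimeShear _))
    (hsupp.comp_homeomorph _) (fun p hp => hvanish _ hp)
  have hfd (t : ℝ) (q : En n × En n) :
      fderiv ℝ (φ ∘ spaceTimeShear (-b)) (t, q) ((1 : ℝ), (a • q.2, (0 : En n)))
        = fderiv ℝ φ (t, shear (-(b * t)) q) ((1 : ℝ), ((a - b) • q.2, (0 : En n))) := by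
    rw [fderiv_comp _ (hφ.differentiable (by simp) _)
      ((contDiff_spaceTimeShear (k := 1) _).differentiable one_ne_zero _),
      ContinuousLinearMap.comp_apply, fderiv_spaceTimeShear_transport, ← sub_eq_add_neg,
      spaceTimeShear_apply, neg_mul]
  have hint (t : ℝ) (F : En n × En n → ℂ) : ∫ q, F (shear (b * t) q) = ∫ q, F q :=
    (measurePreserving_shear _).integral_comp (shear _).measurableEmbedding F
  have hleft (t : ℝ) : ∫ q, u t (shear (b * t) q)
        * (fderiv ℝ φ (t, q) ((1 : ℝ), ((a - b) • q.2, (0 : En n))) : ℂ)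
      = ∫ q, u t q * (fderiv ℝ φ (t, shear (-(b * t)) q)
          ((1 : ℝ), ((a - b) • q.2, (0 : En n))) : ℂ) := by
    refine Eq.trans ?_ (hint t _)
    simp only [shear_neg_shear, shear_snd]
  have hright (t : ℝ) : ∫ q, h t (shear (b * t) q) * (φ (t, q) : ℂ)
      = ∫ q, h t q * ((φ ∘ spaceTimeShear (-b)) (t, q) : ℂ) := by
    refine Eq.trans ?_ (hint t _)
    simp only [Function.comp_apply, spaceTimeShear_apply, neg_mul, shear_neg_shear]
  simpa only [hleft, hright, hfd] using key

theorem L2mu_comp_shear (n : ℕ) (T μ b : ℝ) (u : ℝ → En n × En n → ℂ) :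
    L2mu n T μ (fun t q => u t (shear (b * t) q)) = L2mu n T μ u := by
  unfold L2mu
  congr 1 with t
  exact (measurePreserving_shear (b * t)).lintegral_comp_emb (shear _).measurableEmbedding
    fun q => ENNReal.ofReal (t ^ (2 - 2 * μ) * ‖u t q‖ ^ 2)

theorem stmt10 (n : ℕ) (hn : 1 ≤ n) (T μ : ℝ) (hT : 0 < T) (hμ : μ ∈ Ioc (1/2 : ℝ) 1) :
    -- `Γ` maps `T_μ((0,T);L²)` into `H¹_μ((0,T);L²)` isometrically, with `∂_t(Γu) = Γh`
    (∀ u h : ℝ → En n × En n → ℂ,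
      Measurable (fun q : ℝ × (En n × En n) => u q.1 q.2) →
      Measurable (fun q : ℝ × (En n × En n) => h q.1 q.2) →
      L2mu n T μ u < ⊤ → L2mu n T μ h < ⊤ → IsTransportDeriv n T u h →
      L2mu n T μ (fun t q => u t (q.1 + t • q.2, q.2)) = L2mu n T μ u ∧
      L2mu n T μ (fun t q => h t (q.1 + t • q.2, q.2)) = L2mu n T μ h ∧
      IsTimeDeriv n T (fun t q => u t (q.1 + t • q.2, q.2))
        (fun t q => h t (q.1 + t • q.2, q.2)))
  ∧ -- conversely, `Γ⁻¹` maps `H¹_μ((0,T);L²)` into `T_μ((0,T);L²)` isometrically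
    (∀ w w' : ℝ → En n × En n → ℂ,
      Measurable (fun q : ℝ × (En n × En n) => w q.1 q.2) →
      Measurable (fun q : ℝ × (En n × En n) => w' q.1 q.2) →
      L2mu n T μ w < ⊤ → L2mu n T μ w' < ⊤ → IsTimeDeriv n T w w' →
      L2mu n T μ (fun t q => w t (q.1 - t • q.2, q.2)) = L2mu n T μ w ∧
      L2mu n T μ (fun t q => w' t (q.1 - t • q.2, q.2)) = L2mu n T μ w' ∧
      IsTransportDeriv n T (fun t q => w t (q.1 - t • q.2, q.2))
        (fun t q => w' t (q.1 - t • q.2, q.2))) := by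
  have hΓ (u : ℝ → En n × En n → ℂ) : (fun t q => u t (shear (1 * t) q))
      = fun t q => u t (q.1 + t • q.2, q.2) := by
    simp only [shear_apply, one_mul]
  have hΓinv (w : ℝ → En n × En n → ℂ) : (fun t q => w t (shear (-1 * t) q))
      = fun t q => w t (q.1 - t • q.2, q.2) := by
    simp only [shear_apply, neg_mul, one_mul, neg_smul, ← sub_eq_add_neg]
  refine ⟨fun u h _ _ _ _ huh => ?_, fun w w' _ _ _ _ hw => ?_⟩
  · rw [← hΓ u, ← hΓ h]
    refine ⟨L2mu_comp_shear n T μ 1 u, L2mu_comp_shear n T μ 1 h, ?_⟩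
    simpa only [sub_self, isScaledTransportDeriv_zero] using
      (isScaledTransportDeriv_one.2 huh).comp_shear 1
  · rw [← hΓinv w, ← hΓinv w']
    refine ⟨L2mu_comp_shear n T μ (-1) w, L2mu_comp_shear n T μ (-1) w', ?_⟩
    simpa only [zero_sub, neg_neg, isScaledTransportDeriv_one] using
      (isScaledTransportDeriv_zero.2 hw).comp_shear (-1)
end
end
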